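/- Let a < b be real numbers and let X : [a,b] → ℝ^p be continuously differentiable. Let Ψ : [a,b] → [a,b] be a continuously differentiable, non-decreasing surjection (so that Ψ(a) = a and Ψ(b) = b). Then for every integer d ≥ 1 and every multi-index (i₁,…,i_d) ∈ {1,…,p}^d, the signature coefficient of the reparameterized path X∘Ψ equals that of X: S_{(i₁,…,i_d)}(X∘Ψ) = S_{(i₁,…,i_d)}(X). In other words, the signature of X is invariant by time reparameterization. -/

import Mathlib

open MeasureTheory Set

/-- The signature coefficient of a path `X : ℝ → (Fin p → ℝ)` on `[a,b]` associated with the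
multi-index `ι : Fin d → Fin p`: the iterated integral
`∫_{a < t₁ < ⋯ < t_d < b} ∏_k (X^{(ι k)})'(t_k) dt` over the open simplex. -/
noncomputable def sigCoeff (a b : ℝ) {p d : ℕ} (X : ℝ → Fin p → ℝ) (ι : Fin d → Fin p) : ℝ :=
  ∫ t in {t : Fin d → ℝ | (∀ k, t k ∈ Ioo a b) ∧ StrictMono t},
    ∏ k, deriv (fun s => X s (ι k)) (t k)

lemma sig_lintegral_prod {n : ℕ} (μ : Fin n → Measure ℝ) [∀ i, SigmaFinite (μ i)]
    (f : Fin n → ℝ → ENNReal) (hf : ∀ i, Measurable (f i)) :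
    ∫⁻ x, ∏ i, f i (x i) ∂(Measure.pi μ) = ∏ i, ∫⁻ x, f i x ∂(μ i) := by
  induction n with
  | zero => simp
  | succ n ih =>
    rw [← ((measurePreserving_piFinSuccAbove μ 0).symm).lintegral_comp (by fun_prop)]
    have : ∀ x : ℝ × (Fin n → ℝ), ∏ i, f i ((MeasurableEquiv.piFinSuccAbove (fun _ => ℝ) 0).symm x i)
        = f 0 x.1 * ∏ i : Fin n, f i.succ (x.2 i) := by
      intro x
      simp [MeasurableEquiv.piFinSuccAbove_symm_apply, Fin.insertNthEquiv,
        Fin.prod_univ_succ]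
    simp_rw [this]
    have h2 := lintegral_prod_mul (μ := μ 0) (ν := Measure.pi (fun i => μ ((0 : Fin (n+1)).succAbove i)))
      (f := f 0) (g := fun y : Fin n → ℝ => ∏ i : Fin n, f i.succ (y i))
      (hf 0).aemeasurable (Measurable.aemeasurable (by fun_prop))
    rw [h2, Fin.prod_univ_succ]
    congr 1
    exact ih (fun i => μ i.succ) (fun i => f i.succ) (fun i => hf i.succ)

lemma sig_pi_withDensity {n : ℕ} (ρ : ℝ → ENNReal) (hρ : Measurable ρ)
    [SigmaFinite ((volume : Measure ℝ).withDensity ρ)] :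
    Measure.pi (fun _ : Fin n => (volume : Measure ℝ).withDensity ρ)
      = (volume : Measure (Fin n → ℝ)).withDensity (fun t => ∏ k, ρ (t k)) := by
  refine Measure.pi_eq fun s hs => ?_
  rw [withDensity_apply _ (MeasurableSet.univ_pi hs), volume_pi, Measure.restrict_pi_pi,
    sig_lintegral_prod _ _ (fun _ => hρ)]
  exact Finset.prod_congr rfl fun i _ => (withDensity_apply _ (hs i)).symm

lemma sig_main (a b : ℝ) (hab : a < b) (p : ℕ)
    (X : ℝ → Fin p → ℝ) (hX : ContDiffOn ℝ 1 X (Icc a b))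
    (Ψ : ℝ → ℝ) (hΨ : ContDiffOn ℝ 1 Ψ (Icc a b))
    (hmono : MonotoneOn Ψ (Icc a b))
    (hmaps : MapsTo Ψ (Icc a b) (Icc a b))
    (hsurj : SurjOn Ψ (Icc a b) (Icc a b))
    (d : ℕ) (ι : Fin d → Fin p) :
    sigCoeff a b (fun t => X (Ψ t)) ι = sigCoeff a b X ι := by
  have hsub : Ioo a b ⊆ Icc a b := Ioo_subset_Icc_self
  have hnh : ∀ t ∈ Ioo a b, Icc a b ∈ nhds t := fun t ht => Icc_mem_nhds ht.1 ht.2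
  have hder : ∀ t ∈ Ioo a b, HasDerivAt Ψ (deriv Ψ t) t := fun t ht =>
    ((hΨ.differentiableOn one_ne_zero t (hsub ht)).differentiableAt (hnh t ht)).hasDerivAt
  have hnn : ∀ t ∈ Ioo a b, 0 ≤ deriv Ψ t := by
    intro t ht
    rw [← derivWithin_of_mem_nhds (hnh t ht)]
    exact hmono.derivWithin_nonneg
  have hend : ∀ t ∈ Ioo a b, Ψ t ∉ Ioo a b → deriv Ψ t = 0 := by
    intro t ht h
    have hm := hmaps (hsub ht)
    by_cases h1 : a < Ψ t
    · have h2 : Ψ t = b := le_antisymm hm.2 (not_lt.1 fun h2 => h ⟨h1, h2⟩)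
      refine IsLocalMax.deriv_eq_zero ?_
      filter_upwards [hnh t ht] with x hx
      rw [h2]; exact (hmaps hx).2
    · have h2 : Ψ t = a := le_antisymm (not_lt.1 h1) hm.1
      refine IsLocalMin.deriv_eq_zero ?_
      filter_upwards [hnh t ht] with x hx
      rw [h2]; exact (hmaps hx).1
  have hconst : ∀ s ∈ Ioo a b, ∀ t ∈ Ioo a b, s < t → Ψ t ≤ Ψ s → deriv Ψ s = 0 := by
    intro s hs t ht hst h
    have h1 : HasDerivWithinAt Ψ (deriv Ψ s) (Icc s t) s := (hder s hs).hasDerivWithinAt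
    have h2 : HasDerivWithinAt Ψ 0 (Icc s t) s := by
      refine (hasDerivWithinAt_const s (Icc s t) (Ψ s)).congr (fun x hx => ?_) rfl
      have hx' : x ∈ Icc a b := ⟨hs.1.le.trans hx.1, hx.2.trans ht.2.le⟩
      exact le_antisymm ((hmono hx' (hsub ht) hx.2).trans h) (hmono (hsub hs) hx' hx.1)
    exact (uniqueDiffOn_Icc hst s ⟨le_rfl, hst.le⟩).eq_deriv _ h1 h2
  have hchain : ∀ i, ∀ t ∈ Ioo a b, deriv (fun s => X (Ψ s) i) t
      = deriv (fun s => X s i) (Ψ t) * deriv Ψ t := by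
    intro i t ht
    have hXi : DifferentiableOn ℝ (fun s => X s i) (Icc a b) := fun s hs =>
      (differentiableWithinAt_pi.1 (hX.differentiableOn one_ne_zero s hs)) i
    have hc : HasDerivWithinAt (fun s => X (Ψ s) i)
        (derivWithin (fun s => X s i) (Icc a b) (Ψ t) * deriv Ψ t) (Icc a b) t :=
      HasDerivWithinAt.comp (h₂ := fun s => X s i) t
        (hXi (Ψ t) (hmaps (hsub ht))).hasDerivWithinAt (hder t ht).hasDerivWithinAt hmaps
    rw [(hc.hasDerivAt (hnh t ht)).deriv]
    by_cases h : Ψ t ∈ Ioo a b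
    · rw [derivWithin_of_mem_nhds (hnh _ h)]
    · rw [hend t ht h]; simp
  -- continuous extension
  obtain ⟨Φ, hΦc, hΦ⟩ : ∃ Φ : ℝ → ℝ, Continuous Φ ∧ EqOn Φ Ψ (Icc a b) :=
    ⟨IccExtend hab.le ((Icc a b).domRestrict Ψ), (hΨ.continuousOn.domRestrict).Icc_extend',
      fun x hx => by simp [IccExtend_of_mem _ _ hx]⟩
  set r : ℝ → ℝ := (Ioo a b).indicator (deriv Ψ) with hr
  have hrm : Measurable r := (measurable_deriv Ψ).indicator measurableSet_Ioo
  have hr0 : ∀ t, 0 ≤ r t := fun t => indicator_nonneg hnn t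
  set ρ : ℝ → ENNReal := fun t => ENNReal.ofReal (r t) with hρdef
  have hρ : Measurable ρ := hrm.ennreal_ofReal
  haveI : SigmaFinite ((volume : Measure ℝ).withDensity ρ) :=
    SigmaFinite.withDensity_ofReal r
  have hmp : MeasurePreserving Φ ((volume : Measure ℝ).withDensity ρ)
      (volume.restrict (Ioo a b)) := by
    refine ⟨hΦc.measurable, ?_⟩
    ext B hB
    have hsm : MeasurableSet (Φ ⁻¹' B) := hΦc.measurable hB
    rw [Measure.map_apply hΦc.measurable hB, withDensity_apply _ hsm,
      Measure.restrict_apply hB]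
    have e1 : ρ = (Ioo a b).indicator (fun t => ENNReal.ofReal (deriv Ψ t)) := by
      funext t
      by_cases ht : t ∈ Ioo a b <;> simp [hρdef, hr, ht]
    rw [e1, lintegral_indicator measurableSet_Ioo, Measure.restrict_restrict measurableSet_Ioo,
      lintegral_deriv_eq_volume_image_of_monotoneOn (f := Ψ) (measurableSet_Ioo.inter hsm)
        (fun x hx => (hder x hx.1).hasDerivWithinAt) (hmono.mono fun x hx => hsub hx.1)]
    apply le_antisymm
    · calc volume (Ψ '' (Ioo a b ∩ Φ ⁻¹' B)) ≤ volume (B ∩ Icc a b) := by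
            apply measure_mono
            rintro _ ⟨x, ⟨hx, hxB⟩, rfl⟩
            refine ⟨?_, hmaps (hsub hx)⟩
            rw [← hΦ (hsub hx)]; exact hxB
        _ = volume (B ∩ Ioo a b) :=
            measure_congr ((Filter.EventuallyEq.refl _ B).inter Ioo_ae_eq_Icc.symm)
    · apply measure_mono
      rintro y ⟨hyB, hy⟩
      obtain ⟨x, hx, rfl⟩ := hsurj (hsub hy)
      have hxo : x ∈ Ioo a b := by
        have hA : Ψ a = a := by
          obtain ⟨z, hz, hz'⟩ := hsurj (left_mem_Icc.2 hab.le)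
          exact le_antisymm ((hmono (left_mem_Icc.2 hab.le) hz hz.1).trans hz'.le)
            (hmaps (left_mem_Icc.2 hab.le)).1
        have hB : Ψ b = b := by
          obtain ⟨z, hz, hz'⟩ := hsurj (right_mem_Icc.2 hab.le)
          exact le_antisymm (hmaps (right_mem_Icc.2 hab.le)).2
            (hz'.ge.trans (hmono hz (right_mem_Icc.2 hab.le) hz.2))
        refine ⟨lt_of_le_of_ne hx.1 ?_, lt_of_le_of_ne hx.2 ?_⟩
        · rintro rfl; exact absurd hy.1 (by rw [hA]; exact lt_irrefl _)
        · rintro rfl; exact absurd hy.2 (by rw [hB]; exact lt_irrefl _)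
      refine ⟨x, ⟨hxo, ?_⟩, rfl⟩
      change Φ x ∈ B
      rw [hΦ hx]; exact hyB
  have hpi := measurePreserving_pi (fun _ : Fin d => (volume : Measure ℝ).withDensity ρ)
    (fun _ : Fin d => (volume : Measure ℝ).restrict (Ioo a b)) (f := fun _ => Φ) (fun _ => hmp)
  unfold sigCoeff
  set S : Set (Fin d → ℝ) := {t | (∀ k, t k ∈ Ioo a b) ∧ StrictMono t} with hS
  have hSm : MeasurableSet S := by
    have : S = (⋂ k, {t | t k ∈ Ioo a b}) ∩ ⋂ i, ⋂ j, {t | i < j → t i < t j} := by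
      ext t; simp [hS, StrictMono]
    rw [this]
    refine (MeasurableSet.iInter fun k => (measurable_pi_apply k) measurableSet_Ioo).inter
      (MeasurableSet.iInter fun i => MeasurableSet.iInter fun j => ?_)
    by_cases hij : i < j
    · simpa [hij] using measurableSet_lt (measurable_pi_apply i) (measurable_pi_apply j)
    · simp [hij]
  set F : (Fin d → ℝ) → ℝ := fun t => ∏ k, deriv (fun s => X s (ι k)) (t k) with hF
  set G : (Fin d → ℝ) → ℝ := fun t => ∏ k, deriv (fun s => X (Ψ s) (ι k)) (t k) with hG
  have hFm : Measurable F := Finset.measurable_prod _ fun k _ =>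
    (measurable_deriv _).comp (measurable_pi_apply k)
  have hpt : ∀ t, S.indicator G t = (∏ k, r (t k)) * S.indicator F (fun k => Φ (t k)) := by
    intro t
    by_cases hall : ∀ k, t k ∈ Ioo a b
    · have hrt : ∀ k, r (t k) = deriv Ψ (t k) := fun k => indicator_of_mem (hall k) _
      have hΦt : ∀ k, Φ (t k) = Ψ (t k) := fun k => hΦ (hsub (hall k))
      have hGt : G t = (∏ k, r (t k)) * F (fun k => Φ (t k)) := by
        simp only [hG, hF]
        rw [← Finset.prod_mul_distrib]
        refine Finset.prod_congr rfl fun k _ => ?_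
        rw [hchain _ _ (hall k), hrt, hΦt, mul_comm]
      by_cases h0 : ∏ k, r (t k) = 0
      · rw [h0, zero_mul] at hGt ⊢
        by_cases ht : t ∈ S <;> simp [ht, hGt]
      · have hne : ∀ k, deriv Ψ (t k) ≠ 0 := fun k => by
          rw [← hrt]; exact Finset.prod_ne_zero_iff.1 h0 k (Finset.mem_univ k)
        have hiff : t ∈ S ↔ (fun k => Φ (t k)) ∈ S := by
          constructor
          · rintro ⟨_, hs⟩
            refine ⟨fun k => ?_, fun i j hij => ?_⟩
            · show Φ (t k) ∈ _
              rw [hΦt]; by_contra h; exact hne k (hend _ (hall k) h)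
            · show Φ (t i) < Φ (t j)
              rw [hΦt, hΦt]; by_contra h
              exact hne i (hconst _ (hall i) _ (hall j) (hs hij) (not_lt.1 h))
          · rintro ⟨_, hs⟩
            refine ⟨hall, fun i j hij => ?_⟩
            have h1 : Φ (t i) < Φ (t j) := hs hij
            rw [hΦt, hΦt] at h1
            by_contra h
            exact absurd (hmono (hsub (hall j)) (hsub (hall i)) (not_lt.1 h)) (not_le.2 h1)
        by_cases ht : t ∈ S
        · rw [indicator_of_mem ht, indicator_of_mem (hiff.1 ht), hGt]
        · rw [indicator_of_notMem ht, indicator_of_notMem (fun h => ht (hiff.2 h)), mul_zero]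
    · rw [indicator_of_notMem (fun h => hall h.1)]
      push Not at hall
      obtain ⟨k, hk⟩ := hall
      rw [Finset.prod_eq_zero (Finset.mem_univ k) (indicator_of_notMem hk _), zero_mul]
  symm
  calc ∫ t in S, F t
      = ∫ t in univ.pi (fun _ => Ioo a b), S.indicator F t := by
        rw [setIntegral_indicator hSm]
        congr 2
        ext t
        constructor
        · exact fun h => ⟨fun k _ => h.1 k, h⟩
        · exact fun h => h.2
    _ = ∫ t, S.indicator F t ∂(Measure.pi fun _ : Fin d => volume.restrict (Ioo a b)) := by
        rw [volume_pi, Measure.restrict_pi_pi]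
    _ = ∫ t, S.indicator F (fun k => Φ (t k))
          ∂(Measure.pi fun _ : Fin d => (volume : Measure ℝ).withDensity ρ) := by
        rw [← hpi.map_eq, integral_map hpi.measurable.aemeasurable
          (hFm.indicator hSm).aestronglyMeasurable]
    _ = ∫ t, S.indicator G t := by
        rw [sig_pi_withDensity ρ hρ, integral_withDensity_eq_integral_toReal_smul
          (by fun_prop) (Filter.Eventually.of_forall fun t =>
            ENNReal.prod_lt_top fun k _ => ENNReal.ofReal_lt_top)]
        congr 1
        funext t
        rw [hpt t, ENNReal.toReal_prod, smul_eq_mul]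
        simp [hρdef, ENNReal.toReal_ofReal (hr0 _)]
    _ = ∫ t in S, G t := integral_indicator hSm

/-- The signature of a continuously differentiable path is invariant under continuously
differentiable non-decreasing surjective time reparameterizations. -/
theorem signature_invariant_time_reparam (a b : ℝ) (hab : a < b) (p : ℕ)
    (X : ℝ → Fin p → ℝ) (hX : ContDiffOn ℝ 1 X (Icc a b))
    (Ψ : ℝ → ℝ) (hΨ : ContDiffOn ℝ 1 Ψ (Icc a b))
    (hmono : MonotoneOn Ψ (Icc a b))
    (hmaps : MapsTo Ψ (Icc a b) (Icc a b))
    (hsurj : SurjOn Ψ (Icc a b) (Icc a b))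
    (d : ℕ) (hd : 1 ≤ d) (ι : Fin d → Fin p) :
    sigCoeff a b (fun t => X (Ψ t)) ι = sigCoeff a b X ι := by
  exact sig_main a b hab p X hX Ψ hΨ hmono hmaps hsurj d ι
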